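/- Let (X,d) be a metric space, k : [0,∞) → [0,∞) continuous with antiderivative h(s) := ∫_0^s k(u) du, Σ ⊂ X a nonempty finite set, and K : X → [0,∞) a continuous function with K(x) ≥ k(d(x,Σ)) for all x. Then for every piecewise locally Lipschitz curve γ : I → X and all a, t ∈ I one has h(d(γ(t), Σ)) ≤ h(d(γ(a), Σ)) + L_K(γ), where L_K(γ) := ∫_I K(γ(s)) |γ̇|(s) ds. -/

import Mathlib

open Filter Topology MeasureTheory Set
open scoped ENNReal NNReal Classical

section Defs

variable {X : Type*} [MetricSpace X]

/-- The metric derivative of the curve `γ` within the set `I` at the point `t` exists and has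
value `L`, i.e. `lim_{s → t, s ∈ I} dist (γ s) (γ t) / |s - t| = L`. -/
def HasMetricDerivWithinAt (γ : ℝ → X) (I : Set ℝ) (t : ℝ) (L : ℝ) : Prop :=
  Tendsto (fun s => dist (γ s) (γ t) / |s - t|) (𝓝[I \ {t}] t) (𝓝 L)

/-- The metric derivative `|γ̇|(t)` of `γ` within `I` at `t` (junk value `0` if the defining
limit does not exist). -/
noncomputable def metricDerivWithin (γ : ℝ → X) (I : Set ℝ) (t : ℝ) : ℝ :=
  if h : ∃ L, HasMetricDerivWithinAt γ I t L then h.choose else 0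

/-- `γ` is locally Lipschitz on the set `s ⊆ ℝ`. -/
def LocallyLipschitzOnSet (γ : ℝ → X) (s : Set ℝ) : Prop :=
  ∀ t ∈ s, ∃ ε > 0, ∃ C : NNReal, LipschitzOnWith C γ (s ∩ Metric.ball t ε)

/-- `γ` is a piecewise locally Lipschitz curve on the interval `I`: it is continuous on `I`
and locally Lipschitz outside finitely many points of `I` (equivalently, there are
`t_0 = inf I < t_1 < ⋯ < t_n = sup I` such that `γ` is locally Lipschitz on each
`I ∩ (t_i, t_(i+1))`). -/
def PiecewiseLocLipOn (γ : ℝ → X) (I : Set ℝ) : Prop :=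
  ContinuousOn γ I ∧ ∃ S : Finset ℝ, LocallyLipschitzOnSet γ (I \ ↑S)

/-- The `K`-weighted length `L_K(γ) = ∫_I K (γ t) * |γ̇| t dt` of a curve `γ` defined on `I`. -/
noncomputable def KLength (K : X → ℝ) (γ : ℝ → X) (I : Set ℝ) : ℝ≥0∞ :=
  ∫⁻ t in I, ENNReal.ofReal (K (γ t) * metricDerivWithin γ I t)

/-- The filter of approach to the left endpoint of the interval `I` (the endpoint may be
`-∞`, i.e. `I` may be unbounded below). -/
noncomputable def leftEndFilter (I : Set ℝ) : Filter ℝ :=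
  if BddBelow I then 𝓝[I] (sInf I) else Filter.atBot ⊓ Filter.principal I

/-- The filter of approach to the right endpoint of the interval `I`. -/
noncomputable def rightEndFilter (I : Set ℝ) : Filter ℝ :=
  if BddAbove I then 𝓝[I] (sSup I) else Filter.atTop ⊓ Filter.principal I

/-- `γ`, defined on the nonempty interval `I`, is a path from `x` to `y`: it is continuous on
`I` and converges to `x` (resp. `y`) at the left (resp. right) endpoint of `I` (where the
value at an infinite endpoint is understood as a limit). -/
def IsPathOn (γ : ℝ → X) (I : Set ℝ) (x y : X) : Prop :=
  I.Nonempty ∧ I.OrdConnected ∧ ContinuousOn γ I ∧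
    Tendsto γ (leftEndFilter I) (𝓝 x) ∧ Tendsto γ (rightEndFilter I) (𝓝 y)

/-- The weighted (pseudo-)distance `d_K(x,y)`: the infimum of `L_K` over piecewise locally
Lipschitz paths from `x` to `y`. -/
noncomputable def dK (K : X → ℝ) (x y : X) : ℝ≥0∞ :=
  ⨅ (γ : ℝ → X) (I : Set ℝ) (_ : PiecewiseLocLipOn γ I) (_ : IsPathOn γ I x y),
    KLength K γ I

/-- The intrinsic (geodesic) distance: the infimum of the length `L_d(γ) = eVariationOn γ I`
over all paths from `x` to `y`. -/
noncomputable def geodDist (x y : X) : ℝ≥0∞ :=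
  ⨅ (γ : ℝ → X) (I : Set ℝ) (_ : IsPathOn γ I x y), eVariationOn γ I

/-- A length space: the distance coincides with the intrinsic distance. -/
def IsLengthSpace (Y : Type*) [MetricSpace Y] : Prop :=
  ∀ x y : Y, geodDist x y = edist x y

/-- `K_r(x) := inf { K z : dist x z ≤ r }`. -/
noncomputable def Kinf (K : X → ℝ) (x : X) (r : ℝ) : ℝ :=
  sInf (K '' Metric.closedBall x r)

/-- `K^r(x) := sup { K z : dist x z ≤ r }`. -/
noncomputable def Ksup (K : X → ℝ) (x : X) (r : ℝ) : ℝ :=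
  sSup (K '' Metric.closedBall x r)

/-- The energy `E_W(γ) = ∫_I (½ |γ̇|(t)² + W (γ t)) dt`. -/
noncomputable def energyW (W : X → ℝ) (γ : ℝ → X) (I : Set ℝ) : ℝ≥0∞ :=
  ∫⁻ t in I, ENNReal.ofReal ((metricDerivWithin γ I t) ^ 2 / 2 + W (γ t))

end Defs

/-- A Lipschitz curve `σ : ℝ → X` has a metric derivative at almost every point. -/
lemma LipschitzWith.ae_exists_hasMetricDerivWithinAt_univ {X : Type*} [MetricSpace X]
    {σ : ℝ → X} {C : ℝ≥0} (hσ : LipschitzWith C σ) :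
    ∀ᵐ t : ℝ, ∃ L, HasMetricDerivWithinAt σ univ t L := by
  -- The metric derivative is the supremum of the speeds of the distances to a dense set.
  let φ : ℚ → ℝ → ℝ := fun q t => dist (σ t) (σ q)
  have hφ : ∀ q, LipschitzWith C (φ q) := fun q => by
    simpa using! (LipschitzWith.dist_left (σ q)).comp hσ
  let m : ℝ → ℝ := fun t => ⨆ q, |deriv (φ q) t|
  have hbound : ∀ q t, |deriv (φ q) t| ≤ C := fun q t =>
    norm_deriv_le_of_lipschitz (hφ q)
  have hbdd : ∀ t, BddAbove (range fun q => |deriv (φ q) t|) := fun t =>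
    ⟨C, by rintro _ ⟨q, rfl⟩; exact hbound q t⟩
  have hle : ∀ q t, |deriv (φ q) t| ≤ m t := fun q t => le_ciSup (hbdd t) q
  have hm0 : ∀ t, 0 ≤ m t := fun t => (abs_nonneg _).trans (hle 0 t)
  have hmC : ∀ t, m t ≤ C := fun t => ciSup_le fun q => hbound q t
  have hmeas : Measurable m := by
    refine Measurable.iSup fun q => ?_
    simpa only [Real.norm_eq_abs] using (measurable_deriv (φ q)).norm
  have hloc : LocallyIntegrable m := by
    refine (locallyIntegrable_const (C : ℝ)).mono hmeas.aestronglyMeasurable ?_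
    refine ae_of_all _ fun t => ?_
    rw [Real.norm_of_nonneg (hm0 t)]
    exact (hmC t).trans (le_abs_self _)
  have hii : ∀ s t, IntervalIntegrable m volume s t := fun s t =>
    (hloc.integrableOn_isCompact isCompact_uIcc).intervalIntegrable
  have hdist : ∀ s t, dist (σ s) (σ t) ≤ |∫ u in t..s, m u| := by
    intro s t
    have hq : ∀ q, |φ q s - φ q t| ≤ |∫ u in t..s, m u| := by
      intro q
      have hac : AbsolutelyContinuousOnInterval (φ q) t s :=
        ((hφ q).lipschitzOnWith).absolutelyContinuousOnInterval
      rw [← hac.integral_deriv_eq_sub]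
      exact intervalIntegral.norm_integral_le_abs_of_norm_le (f := deriv (φ q))
        (ae_of_all _ fun u => hle q u) (hii t s)
    have hall : ∀ x : ℝ, |dist (σ s) (σ x) - dist (σ t) (σ x)| ≤ |∫ u in t..s, m u| := by
      have hσc := hσ.continuous
      exact isClosed_property Rat.denseRange_cast (isClosed_le (by fun_prop) continuous_const) hq
    simpa [abs_of_nonneg dist_nonneg] using hall t
  have hdiff : ∀ᵐ t : ℝ, ∀ q, DifferentiableAt ℝ (φ q) t :=
    ae_all_iff.2 fun q => (hφ q).ae_differentiableAt_real
  filter_upwards [hdiff, _root_.LocallyIntegrable.ae_hasDerivAt_integral hloc] with t ht hM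
  refine ⟨m t, ?_⟩
  have hupper : Tendsto (fun s => |∫ u in t..s, m u| / |s - t|) (𝓝[≠] t) (𝓝 (m t)) := by
    have := (hasDerivAt_iff_tendsto_slope.1 (hM t)).abs
    rw [abs_of_nonneg (hm0 t)] at this
    refine this.congr fun s => ?_
    simp [slope_def_field, abs_div]
  have hlower : ∀ q, Tendsto (fun s => |φ q s - φ q t| / |s - t|) (𝓝[≠] t)
      (𝓝 |deriv (φ q) t|) := fun q => by
    refine (hasDerivAt_iff_tendsto_slope.1 (ht q).hasDerivAt).abs.congr fun s => ?_
    simp [slope_def_field, abs_div]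
  rw [HasMetricDerivWithinAt, ← compl_eq_univ_sdiff]
  refine tendsto_order.2 ⟨fun l hl => ?_, fun u hu => ?_⟩
  · obtain ⟨q, hq⟩ := exists_lt_of_lt_ciSup hl
    filter_upwards [(hlower q).eventually_const_lt hq] with s hs
    refine hs.trans_le ?_
    gcongr
    exact abs_dist_sub_le _ _ _
  · filter_upwards [hupper.eventually_lt_const hu] with s hs
    refine lt_of_le_of_lt ?_ hs
    gcongr
    exact hdist s t

/-- The metric derivative only depends on the germ of the curve. -/
lemma HasMetricDerivWithinAt.congr_of_eventuallyEq {X : Type*} [MetricSpace X]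
    {σ γ : ℝ → X} {I : Set ℝ} {t L : ℝ} (hL : HasMetricDerivWithinAt σ univ t L)
    (heq : σ =ᶠ[𝓝 t] γ) : HasMetricDerivWithinAt γ I t L := by
  have hle : 𝓝[I \ {t}] t ≤ 𝓝[univ \ {t}] t :=
    nhdsWithin_mono _ (sdiff_subset_sdiff_left (subset_univ I))
  refine (hL.mono_left hle).congr' ?_
  filter_upwards [nhdsWithin_le_nhds heq] with s hs
  rw [hs, heq.self_of_nhds]

lemma HasMetricDerivWithinAt.metricDerivWithin_eq {X : Type*} [MetricSpace X]
    {γ : ℝ → X} {I : Set ℝ} {t L : ℝ} (hL : HasMetricDerivWithinAt γ I t L) (hI : I ∈ 𝓝 t) :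
    metricDerivWithin γ I t = L := by
  have hex : ∃ L, HasMetricDerivWithinAt γ I t L := ⟨L, hL⟩
  have hne : (𝓝[I \ {t}] t).NeBot := by
    rw [sdiff_eq, nhdsWithin_inter_of_mem (mem_nhdsWithin_of_mem_nhds hI)]
    infer_instance
  rw [metricDerivWithin, dif_pos hex]
  exact tendsto_nhds_unique hex.choose_spec hL

/-- The speed of a `1`-Lipschitz function along a curve is at most the metric derivative. -/
lemma HasMetricDerivWithinAt.abs_deriv_comp_le {X : Type*} [MetricSpace X]
    {σ : ℝ → X} {t L v : ℝ} {g : X → ℝ} (hL : HasMetricDerivWithinAt σ univ t L)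
    (hg : LipschitzWith 1 g) (hgv : HasDerivAt (fun s => g (σ s)) v t) : |v| ≤ L := by
  rw [HasMetricDerivWithinAt, ← compl_eq_univ_sdiff] at hL
  refine le_of_tendsto_of_tendsto (hasDerivAt_iff_tendsto_slope.1 hgv).abs hL
    (Eventually.of_forall fun s => ?_)
  simp only [slope_def_field, abs_div]
  gcongr
  simpa [Real.dist_eq] using hg.dist_le_mul (σ s) (σ t)

/-- Variation of `H ∘ g` along a curve that is Lipschitz on `[c, d]`,
where `k = deriv H` and `k ∘ g ≤ K`. -/
lemma edist_comp_le_lintegral_of_lipschitzOnWith {X : Type*} [MetricSpace X]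
    {H k : ℝ → ℝ} (hk : Continuous k) (hk0 : ∀ x, 0 ≤ k x) (hH : ∀ x, HasDerivAt H (k x) x)
    {g : X → ℝ} (hg : LipschitzWith 1 g) {K : X → ℝ} (hlow : ∀ x, k (g x) ≤ K x)
    {γ : ℝ → X} {I : Set ℝ} {c d : ℝ} (hcd : c ≤ d) (hI : Icc c d ⊆ I)
    {C : ℝ≥0} (hγ : LipschitzOnWith C γ (Icc c d)) :
    edist (H (g (γ c))) (H (g (γ d))) ≤
      ∫⁻ t in Ioc c d, ENNReal.ofReal (K (γ t) * metricDerivWithin γ I t) := by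
  let σ : ℝ → X := IccExtend hcd ((Icc c d).domRestrict γ)
  have hσ : LipschitzWith C σ := by
    simpa using! hγ.to_restrict.comp (LipschitzWith.projIcc hcd)
  have hσγ : ∀ x ∈ Icc c d, σ x = γ x := fun x hx => IccExtend_of_mem hcd _ hx
  have hgσ : LipschitzWith C (fun s => g (σ s)) := by simpa using! hg.comp hσ
  have hHd : ContDiff ℝ 1 H := by
    refine contDiff_one_iff_deriv.2 ⟨fun x => (hH x).differentiableAt, ?_⟩
    rwa [funext fun x => (hH x).deriv]
  obtain ⟨D, hD⟩ := LocallyLipschitzOn.exists_lipschitzOnWith_of_compact isCompact_uIcc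
    ((hHd.locallyLipschitz.comp hgσ.locallyLipschitz).locallyLipschitzOn (s := uIcc c d))
  have hftc := hD.absolutelyContinuousOnInterval.integral_deriv_eq_sub
  rw [← hσγ c (left_mem_Icc.2 hcd), ← hσγ d (right_mem_Icc.2 hcd), edist_comm, edist_eq_enorm_sub]
  simp only [Function.comp_apply] at hftc
  rw [← hftc, intervalIntegral.integral_of_le hcd]
  refine (enorm_integral_le_lintegral_enorm _).trans ?_
  rw [← restrict_Ioo_eq_restrict_Ioc]
  refine lintegral_mono_ae ?_
  rw [ae_restrict_iff' measurableSet_Ioo]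
  filter_upwards [hgσ.ae_differentiableAt_real, hσ.ae_exists_hasMetricDerivWithinAt_univ]
    with t hdiff ⟨L, hL⟩ ht
  have hIt : I ∈ 𝓝 t := mem_of_superset (Icc_mem_nhds ht.1 ht.2) hI
  have heq : σ =ᶠ[𝓝 t] γ := by
    filter_upwards [Icc_mem_nhds ht.1 ht.2] with s hs using hσγ s hs
  have hspeed := hL.abs_deriv_comp_le hg hdiff.hasDerivAt
  have hderiv : deriv (H ∘ fun s => g (σ s)) t = k (g (γ t)) * deriv (fun s => g (σ s)) t := by
    rw [← heq.self_of_nhds]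
    exact ((hH _).comp t hdiff.hasDerivAt).deriv
  rw [(hL.congr_of_eventuallyEq heq).metricDerivWithin_eq hIt, hderiv,
    ← ofReal_norm, norm_mul, Real.norm_of_nonneg (hk0 _), Real.norm_eq_abs]
  have hK := hlow (γ t)
  have hKk := (hk0 (g (γ t))).trans hK
  gcongr

/-- Passing from compact subintervals of `(a, b)` to `[a, b]` by continuity. -/
lemma edist_le_of_forall_Ioo {f : ℝ → ℝ} {a b : ℝ} (hab : a < b)
    (hf : ContinuousOn f (Icc a b)) {B : ℝ≥0∞}
    (hB : ∀ c ∈ Ioo a b, ∀ d ∈ Ioo a b, c ≤ d → edist (f c) (f d) ≤ B) :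
    edist (f a) (f b) ≤ B := by
  have hright : Tendsto f (𝓝[<] b) (𝓝 (f b)) :=
    ((hf b (right_mem_Icc.2 hab.le)).mono Ioo_subset_Icc_self).mono_left
      (nhdsWithin_Ioo_eq_nhdsLT hab).ge
  have hleft : Tendsto f (𝓝[>] a) (𝓝 (f a)) :=
    ((hf a (left_mem_Icc.2 hab.le)).mono Ioo_subset_Icc_self).mono_left
      (nhdsWithin_Ioo_eq_nhdsGT hab).ge
  refine le_of_tendsto (hleft.edist tendsto_const_nhds) ?_
  filter_upwards [Ioo_mem_nhdsGT hab] with c hc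
  refine le_of_tendsto (tendsto_const_nhds.edist hright) ?_
  filter_upwards [Ioo_mem_nhdsLT hc.2] with d hd
  exact hB c hc d ⟨hc.1.trans hd.1, hd.2⟩ hd.1.le

/-- Variation of `H ∘ g` along a piecewise locally Lipschitz curve,
where `k = deriv H` and `k ∘ g ≤ K`. -/
lemma edist_comp_le_lintegral_of_locallyLipschitzOn {X : Type*} [MetricSpace X]
    {H k : ℝ → ℝ} (hk : Continuous k) (hk0 : ∀ x, 0 ≤ k x) (hH : ∀ x, HasDerivAt H (k x) x)
    {g : X → ℝ} (hg : LipschitzWith 1 g) {K : X → ℝ} (hlow : ∀ x, k (g x) ≤ K x)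
    {γ : ℝ → X} {I : Set ℝ} (hγ : ContinuousOn γ I) (S : Finset ℝ) :
    ∀ a b : ℝ, a ≤ b → Icc a b ⊆ I → LocallyLipschitzOn (Ioo a b \ S) γ →
    edist (H (g (γ a))) (H (g (γ b))) ≤
      ∫⁻ t in Ioc a b, ENNReal.ofReal (K (γ t) * metricDerivWithin γ I t) := by
  induction S using Finset.induction_on with
  | empty =>
    intro a b hab hI hlip
    rcases hab.eq_or_lt with rfl | hab
    · simp
    have hHc : Continuous H := continuous_iff_continuousAt.2 fun x => (hH x).continuousAt
    refine edist_le_of_forall_Ioo (f := fun t => H (g (γ t))) hab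
      ((hHc.comp hg.continuous).comp_continuousOn (hγ.mono hI)) fun c hc d hd hcd => ?_
    have hsub : Icc c d ⊆ Ioo a b := Icc_subset_Ioo hc.1 hd.2
    obtain ⟨C, hC⟩ := LocallyLipschitzOn.exists_lipschitzOnWith_of_compact isCompact_Icc
      (hlip.mono (by simpa using hsub))
    refine (edist_comp_le_lintegral_of_lipschitzOnWith hk hk0 hH hg hlow hcd
      ((hsub.trans Ioo_subset_Icc_self).trans hI) hC).trans ?_
    exact lintegral_mono_set (Ioc_subset_Ioc hc.1.le hd.2.le)
  | insert s S _ ih =>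
    intro a b hab hI hlip
    by_cases hs : s ∈ Ioo a b
    · have hl := ih a s hs.1.le ((Icc_subset_Icc_right hs.2.le).trans hI) (hlip.mono fun x hx =>
        ⟨⟨hx.1.1, hx.1.2.trans hs.2⟩, by simpa using ⟨hx.1.2.ne, hx.2⟩⟩)
      have hr := ih s b hs.2.le ((Icc_subset_Icc_left hs.1.le).trans hI) (hlip.mono fun x hx =>
        ⟨⟨hs.1.trans hx.1.1, hx.1.2⟩, by simpa using ⟨hx.1.1.ne', hx.2⟩⟩)
      rw [← Ioc_union_Ioc_eq_Ioc hs.1.le hs.2.le,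
        lintegral_union measurableSet_Ioc (Ioc_disjoint_Ioc_of_le le_rfl)]
      exact (edist_triangle _ _ _).trans (add_le_add hl hr)
    · refine ih a b hab hI (hlip.mono fun x hx => ⟨hx.1, ?_⟩)
      have hxs : x ≠ s := fun h => hs (h ▸ hx.1)
      simpa using ⟨hxs, hx.2⟩

lemma LocallyLipschitzOnSet.locallyLipschitzOn {X : Type*} [MetricSpace X] {γ : ℝ → X}
    {s : Set ℝ} (hγ : LocallyLipschitzOnSet γ s) : LocallyLipschitzOn s γ := by
  intro t ht
  obtain ⟨ε, hε, C, hC⟩ := hγ t ht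
  exact ⟨C, _, inter_mem_nhdsWithin s (Metric.ball_mem_nhds t hε), hC⟩

/-- If `h` is the antiderivative of `k` and `K x ≥ k (dist x Σ)`, then along any
piecewise locally Lipschitz curve `γ` one has
`h (dist (γ t) Σ) ≤ h (dist (γ a) Σ) + L_K(γ)`. -/
theorem h_dist_le_h_dist_add_KLength
    {X : Type*} [MetricSpace X]
    (k : ℝ → ℝ) (hkc : ContinuousOn k (Set.Ici 0)) (hk0 : ∀ t ∈ Set.Ici (0 : ℝ), 0 ≤ k t)
    (h : ℝ → ℝ) (hh : ∀ s : ℝ, h s = ∫ u in (0 : ℝ)..s, k u)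
    (Z : Set X) (hZfin : Z.Finite) (hZne : Z.Nonempty)
    (K : X → ℝ) (hKc : Continuous K) (hK0 : ∀ x, 0 ≤ K x)
    (hlow : ∀ x : X, k (Metric.infDist x Z) ≤ K x)
    (γ : ℝ → X) (I : Set ℝ) (hne : I.Nonempty) (hint : I.OrdConnected)
    (hγ : PiecewiseLocLipOn γ I) :
    ∀ a ∈ I, ∀ t ∈ I,
      ENNReal.ofReal (h (Metric.infDist (γ t) Z)) ≤
        ENNReal.ofReal (h (Metric.infDist (γ a) Z)) + KLength K γ I := by
  obtain ⟨hcont, S, hS⟩ := hγ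
  let k₀ : ℝ → ℝ := fun x => k (max 0 x)
  have hk₀c : Continuous k₀ :=
    hkc.comp_continuous (by fun_prop) fun x => le_max_left 0 x
  have hH : ∀ x, HasDerivAt (fun s => ∫ u in (0 : ℝ)..s, k₀ u) (k₀ x) x := fun x =>
    intervalIntegral.integral_hasDerivAt_right (hk₀c.intervalIntegrable _ _)
      hk₀c.stronglyMeasurable.stronglyMeasurableAtFilter hk₀c.continuousAt
  have hhH : ∀ x, h (Metric.infDist x Z) = ∫ u in (0 : ℝ)..Metric.infDist x Z, k₀ u := by
    intro x
    rw [hh]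
    refine intervalIntegral.integral_congr fun u hu => ?_
    rw [uIcc_of_le Metric.infDist_nonneg] at hu
    simp [k₀, max_eq_right hu.1]
  have hmain : ∀ a ∈ I, ∀ b ∈ I, a ≤ b →
      edist (h (Metric.infDist (γ a) Z)) (h (Metric.infDist (γ b) Z)) ≤ KLength K γ I := by
    intro a ha b hb hab
    have hI : Icc a b ⊆ I := hint.out ha hb
    rw [hhH, hhH]
    refine (edist_comp_le_lintegral_of_locallyLipschitzOn
      (H := fun s => ∫ u in (0 : ℝ)..s, k₀ u) (g := fun x => Metric.infDist x Z) hk₀c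
      (fun x => hk0 _ (le_max_left 0 x)) hH (Metric.lipschitz_infDist_pt Z)
      (fun x => by simpa [k₀, max_eq_right Metric.infDist_nonneg] using hlow x) hcont S a b hab hI
      (hS.locallyLipschitzOn.mono
        (sdiff_subset_sdiff_left (Ioo_subset_Icc_self.trans hI)))).trans ?_
    exact lintegral_mono_set (Ioc_subset_Icc_self.trans hI)
  intro a ha t ht
  have hdist : edist (h (Metric.infDist (γ t) Z)) (h (Metric.infDist (γ a) Z)) ≤
      KLength K γ I := by
    rcases le_total a t with hat | hat
    · rw [edist_comm]
      exact hmain a ha t ht hat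
    · exact hmain t ht a ha hat
  calc ENNReal.ofReal (h (Metric.infDist (γ t) Z))
      ≤ ENNReal.ofReal (h (Metric.infDist (γ a) Z) +
          dist (h (Metric.infDist (γ t) Z)) (h (Metric.infDist (γ a) Z))) := by
        gcongr
        rw [Real.dist_eq]
        linarith [le_abs_self (h (Metric.infDist (γ t) Z) - h (Metric.infDist (γ a) Z))]
    _ ≤ ENNReal.ofReal (h (Metric.infDist (γ a) Z)) +
          ENNReal.ofReal (dist (h (Metric.infDist (γ t) Z)) (h (Metric.infDist (γ a) Z))) :=
        ENNReal.ofReal_add_le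
    _ ≤ _ := by
        rw [← edist_dist]
        gcongr
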